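/- arXiv:2605.09991 — 3 statements merged into one kernel-verified Lean document; each statement's English description precedes it below -/
import Mathlib

section
/- Let m* be a positive integer with m ≥ m*, let R ∈ {entrywise max norm ‖·‖_max, Frobenius norm ‖·‖_F, operator norm ‖·‖_op}, and let S ⊆ O_R(λ) be a set such that every (W, α) ∈ S has at most m*/2 indices i with W_i ≠ 0 (W_i the i-th column of W). Then for any two points A, B ∈ S there exists a continuous path γ : [0,1] → O_R(λ) with γ(0) = A and γ(1) = B. -/
open scoped BigOperators

noncomputable def relu (x : ℝ) : ℝ := max x 0

/-- Output of a two-layer ReLU network: `(XW)₊ α`. -/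
noncomputable def nnOut {N D M : Type*} [Fintype N] [Fintype D] [Fintype M]
    (X : Matrix N D ℝ) (W : Matrix D M ℝ) (a : M → ℝ) : N → ℝ :=
  ((X * W).map relu).mulVec a

/-- Entrywise max norm of a matrix. -/
noncomputable def maxNorm {D M : Type*} [Fintype D] [Fintype M] (W : Matrix D M ℝ) : ℝ :=
  ⨆ i, ⨆ j, |W i j|

/-- Frobenius norm of a matrix. -/
noncomputable def frobNorm {D M : Type*} [Fintype D] [Fintype M] (W : Matrix D M ℝ) : ℝ :=
  Real.sqrt (∑ i, ∑ j, (W i j) ^ 2)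

/-- Euclidean (ℓ2) norm of a vector. -/
noncomputable def l2norm {M : Type*} [Fintype M] (v : M → ℝ) : ℝ :=
  Real.sqrt (∑ i, (v i) ^ 2)

/-- ℓ∞ norm of a vector. -/
noncomputable def linfNorm {M : Type*} [Fintype M] (v : M → ℝ) : ℝ :=
  ⨆ i, |v i|

/-- Operator norm (largest singular value) of a matrix, as the supremum of
`‖W v‖₂` over the Euclidean unit ball. -/
noncomputable def opNorm {D M : Type*} [Fintype D] [Fintype M] (W : Matrix D M ℝ) : ℝ :=
  ⨆ v : {v : M → ℝ // l2norm v ≤ 1}, l2norm (W.mulVec v.1)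

/-- The `i`-th column of a matrix. -/
def mcol {D M R : Type*} (W : Matrix D M R) (i : M) : D → R := fun r => W r i

/-- Regularized solution set `O_R(λ)`. -/
def solSet {N D M : Type*} [Fintype N] [Fintype D] [Fintype M]
    (X : Matrix N D ℝ) (y : N → ℝ)
    (R : Matrix D M ℝ → ℝ) (Rv : (M → ℝ) → ℝ) (lam : ℝ) :
    Set (Matrix D M ℝ × (M → ℝ)) :=
  {p | nnOut X p.1 p.2 = y ∧ R p.1 ≤ 1 / lam ∧ Rv p.2 ≤ 1 / lam}

/-- Hyperplane arrangement pattern `1(Xh ≥ 0)` of a vector `h`. -/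
noncomputable def pattern {N D : Type*} [Fintype N] [Fintype D]
    (X : Matrix N D ℝ) (h : D → ℝ) : N → Bool :=
  fun i => decide (0 ≤ X.mulVec h i)


lemma relu_mul_nonneg' {c x : ℝ} (hc : 0 ≤ c) : relu (c * x) = c * relu x := by
  unfold relu
  rw [mul_max_of_nonneg _ _ hc, mul_zero]

lemma nnOut_apply' {N D M : Type*} [Fintype N] [Fintype D] [Fintype M]
    (X : Matrix N D ℝ) (W : Matrix D M ℝ) (a : M → ℝ) (l : N) :
    nnOut X W a l = ∑ k, relu (∑ r, X l r * W r k) * a k := by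
  simp [nnOut, Matrix.mulVec, dotProduct, Matrix.mul_apply]

lemma maxNorm_le_iff' {D M : Type*} [Fintype D] [Fintype M] (W : Matrix D M ℝ) {C : ℝ}
    (hC : 0 ≤ C) : maxNorm W ≤ C ↔ ∀ i j, |W i j| ≤ C := by
  unfold maxNorm
  constructor
  · intro h i j
    refine le_trans ?_ h
    refine le_trans ?_ (le_ciSup (f := fun i => ⨆ j, |W i j|) (Set.finite_range _).bddAbove i)
    exact le_ciSup (f := fun j => |W i j|) (Set.finite_range _).bddAbove j
  · intro h
    exact Real.iSup_le (fun i => Real.iSup_le (fun j => h i j) hC) hC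

lemma linfNorm_le_iff' {M : Type*} [Fintype M] (v : M → ℝ) {C : ℝ}
    (hC : 0 ≤ C) : linfNorm v ≤ C ↔ ∀ j, |v j| ≤ C := by
  unfold linfNorm
  constructor
  · intro h j
    exact le_trans (le_ciSup (f := fun j => |v j|) (Set.finite_range _).bddAbove j) h
  · intro h
    exact Real.iSup_le (fun j => h j) hC

lemma frobNorm_le_iff' {D M : Type*} [Fintype D] [Fintype M] (W : Matrix D M ℝ) {C : ℝ}
    (hC : 0 ≤ C) : frobNorm W ≤ C ↔ ∑ i, ∑ j, (W i j) ^ 2 ≤ C ^ 2 := by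
  unfold frobNorm
  exact Real.sqrt_le_left hC

lemma l2norm_le_iff' {M : Type*} [Fintype M] (v : M → ℝ) {C : ℝ}
    (hC : 0 ≤ C) : l2norm v ≤ C ↔ ∑ j, (v j) ^ 2 ≤ C ^ 2 := by
  unfold l2norm
  exact Real.sqrt_le_left hC

lemma l2norm_eq_norm' {M : Type*} [Fintype M] (v : M → ℝ) :
    l2norm v = ‖WithLp.toLp 2 v‖ := by
  simp [l2norm, EuclideanSpace.norm_eq]

lemma l2norm_smul' {M : Type*} [Fintype M] (c : ℝ) (v : M → ℝ) :
    l2norm (c • v) = |c| * l2norm v := by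
  rw [l2norm_eq_norm', l2norm_eq_norm', WithLp.toLp_smul, norm_smul, Real.norm_eq_abs]

lemma l2norm_add' {M : Type*} [Fintype M] (u v : M → ℝ) :
    l2norm (u + v) ≤ l2norm u + l2norm v := by
  simp only [l2norm_eq_norm', WithLp.toLp_add]
  exact norm_add_le _ _

lemma l2norm_nonneg' {M : Type*} [Fintype M] (v : M → ℝ) : 0 ≤ l2norm v := Real.sqrt_nonneg _

lemma l2norm_sq' {M : Type*} [Fintype M] (v : M → ℝ) : l2norm v ^ 2 = ∑ j, v j ^ 2 :=
  Real.sq_sqrt (Finset.sum_nonneg fun _ _ => sq_nonneg _)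

lemma l2norm_mulVec_bdd' {D M : Type*} [Fintype D] [Fintype M] (W : Matrix D M ℝ) :
    BddAbove (Set.range fun v : {v : M → ℝ // l2norm v ≤ 1} => l2norm (W.mulVec v.1)) := by
  refine ⟨Real.sqrt (∑ i, ∑ j, (W i j) ^ 2), ?_⟩
  rintro _ ⟨⟨v, hv⟩, rfl⟩
  unfold l2norm
  apply Real.sqrt_le_sqrt
  apply Finset.sum_le_sum
  intro i _
  rw [l2norm_le_iff' v zero_le_one] at hv
  have := Finset.sum_mul_sq_le_sq_mul_sq Finset.univ (fun j => W i j) v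
  have h2 : 0 ≤ ∑ j, (W i j) ^ 2 := Finset.sum_nonneg fun _ _ => sq_nonneg _
  simp only [Matrix.mulVec, dotProduct]
  nlinarith

lemma opNorm_le_iff' {D M : Type*} [Fintype D] [Fintype M] (W : Matrix D M ℝ) {C : ℝ}
    (hC : 0 ≤ C) : opNorm W ≤ C ↔ ∀ v, l2norm (W.mulVec v) ≤ C * l2norm v := by
  unfold opNorm
  constructor
  · intro h v
    have key : ∀ u, l2norm u ≤ 1 → l2norm (W.mulVec u) ≤ C := fun u hu =>
      le_trans (le_ciSup (l2norm_mulVec_bdd' W) ⟨u, hu⟩) h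
    rcases (l2norm_nonneg' v).eq_or_lt with h0 | h0
    · have hv : v = 0 := by
        rw [l2norm_eq_norm'] at h0
        have := norm_eq_zero.1 h0.symm
        simpa using this
      subst hv
      simp [l2norm]
    · have := key ((l2norm v)⁻¹ • v) (by
        rw [l2norm_smul', abs_of_pos (inv_pos.2 h0), inv_mul_cancel₀ h0.ne'])
      rw [Matrix.mulVec_smul, l2norm_smul', abs_of_pos (inv_pos.2 h0), inv_mul_le_iff₀ h0] at this
      linarith
  · intro h
    refine Real.iSup_le (fun v => (h v.1).trans ?_) hC
    nlinarith [v.2]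

/-- paths from a two-parameter family on the quarter circle -/
lemma joinedIn_circle' {E : Type*} [TopologicalSpace E] {F : Set E} (f : ℝ → ℝ → E)
    (hf : Continuous fun p : ℝ × ℝ => f p.1 p.2)
    (hF : ∀ c s, 0 ≤ c → 0 ≤ s → c ^ 2 + s ^ 2 = 1 → f c s ∈ F) :
    JoinedIn F (f 1 0) (f 0 1) := by
  refine JoinedIn.ofLine (f := fun t : ℝ => f (Real.cos (Real.pi / 2 * t))
    (Real.sin (Real.pi / 2 * t))) ?_ ?_ ?_ ?_
  · apply Continuous.continuousOn
    exact hf.comp (f := fun t : ℝ => (Real.cos (Real.pi / 2 * t), Real.sin (Real.pi / 2 * t)))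
      (by fun_prop)
  · simp
  · simp
  · rintro _ ⟨t, ⟨h0, h1⟩, rfl⟩
    have hp := Real.pi_pos
    refine hF _ _ ?_ ?_ (Real.cos_sq_add_sin_sq _)
    · apply Real.cos_nonneg_of_neg_pi_div_two_le_of_le <;> nlinarith
    · apply Real.sin_nonneg_of_nonneg_of_le_pi <;> nlinarith

/-! ### mixing -/

lemma mix_abs' {c s a b C : ℝ} (hc : 0 ≤ c) (hs : 0 ≤ s) (h : c ^ 2 + s ^ 2 = 1)
    (hab : a = 0 ∨ b = 0) (ha : |a| ≤ C) (hb : |b| ≤ C) : |c * a + s * b| ≤ C := by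
  have hc1 : c ≤ 1 := by nlinarith
  have hs1 : s ≤ 1 := by nlinarith
  rcases hab with rfl | rfl
  · simp only [mul_zero, zero_add, abs_mul, abs_of_nonneg hs]
    nlinarith [abs_nonneg b]
  · simp only [mul_zero, add_zero, abs_mul, abs_of_nonneg hc]
    nlinarith [abs_nonneg a]

lemma mix_sum' {M : Type*} [Fintype M] {c s : ℝ} (a b : M → ℝ) 
    (hab : ∀ k, a k = 0 ∨ b k = 0) :
    ∑ k, (c * a k + s * b k) ^ 2 = c ^ 2 * ∑ k, a k ^ 2 + s ^ 2 * ∑ k, b k ^ 2 := by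
  rw [Finset.mul_sum, Finset.mul_sum, ← Finset.sum_add_distrib]
  refine Finset.sum_congr rfl fun k _ => ?_
  rcases hab k with h | h <;> rw [h] <;> ring

lemma mix_op' {D M : Type*} [Fintype D] [Fintype M] {c s C : ℝ} (hC : 0 ≤ C)
    (hc : 0 ≤ c) (hs : 0 ≤ s) (h : c ^ 2 + s ^ 2 = 1) (W V : Matrix D M ℝ)
    (hWV : ∀ k, (∀ r, W r k = 0) ∨ (∀ r, V r k = 0))
    (hW : opNorm W ≤ C) (hV : opNorm V ≤ C) : opNorm (c • W + s • V) ≤ C := by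
  classical
  rw [opNorm_le_iff' _ hC] at *
  intro v
  let v1 : M → ℝ := fun k => if ∀ r, W r k = 0 then 0 else v k
  let v2 : M → ℝ := fun k => if ∀ r, W r k = 0 then v k else 0
  have e1 : W.mulVec v = W.mulVec v1 := by
    ext r
    simp only [Matrix.mulVec, dotProduct, v1]
    refine Finset.sum_congr rfl fun k _ => ?_
    split_ifs with hk
    · simp [hk r]
    · rfl
  have e2 : V.mulVec v = V.mulVec v2 := by
    ext r
    simp only [Matrix.mulVec, dotProduct, v2]
    refine Finset.sum_congr rfl fun k _ => ?_
    split_ifs with hk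
    · rfl
    · simp [((hWV k).resolve_left hk) r]
  have e3 : l2norm v1 ^ 2 + l2norm v2 ^ 2 = l2norm v ^ 2 := by
    simp only [l2norm_sq', ← Finset.sum_add_distrib]
    refine Finset.sum_congr rfl fun k _ => ?_
    simp only [v1, v2]
    split_ifs <;> ring
  have e4 : l2norm ((c • W + s • V).mulVec v) ≤ c * (C * l2norm v1) + s * (C * l2norm v2) := by
    rw [Matrix.add_mulVec, Matrix.smul_mulVec, Matrix.smul_mulVec, e1, e2]
    refine (l2norm_add' _ _).trans ?_
    rw [l2norm_smul', l2norm_smul', abs_of_nonneg hc, abs_of_nonneg hs]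
    gcongr
    · exact hW v1
    · exact hV v2
  have e5 : c * l2norm v1 + s * l2norm v2 ≤ l2norm v := by
    refine le_trans (le_abs_self _) (abs_le_of_sq_le_sq ?_ (l2norm_nonneg' v))
    rw [← e3]
    nlinarith [sq_nonneg (c * l2norm v2 - s * l2norm v1)]
  nlinarith

lemma mix_joined' {n d m : ℕ}
    (X : Matrix (Fin n) (Fin d) ℝ) (y : Fin n → ℝ)
    (lam : ℝ) (hlam : 0 < lam)
    (R : Matrix (Fin d) (Fin m) ℝ → ℝ) (Rv : (Fin m → ℝ) → ℝ)
    (hR : (R = maxNorm ∧ Rv = linfNorm) ∨ (R = frobNorm ∧ Rv = l2norm) ∨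
          (R = opNorm ∧ Rv = l2norm))
    (W V : Matrix (Fin d) (Fin m) ℝ) (a b : Fin m → ℝ)
    (hA : (W, a) ∈ solSet X y R Rv lam) (hB : (V, b) ∈ solSet X y R Rv lam)
    (hd : ∀ k, ((∀ r, W r k = 0) ∧ a k = 0) ∨ ((∀ r, V r k = 0) ∧ b k = 0)) :
    JoinedIn (solSet X y R Rv lam) (W, a) (V, b) := by
  have hC : 0 ≤ 1 / lam := by positivity
  have key := joinedIn_circle' (F := solSet X y R Rv lam)
    (fun c s => (c • W + s • V, c • a + s • b)) (by fun_prop) ?_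
  · simpa using key
  intro c s hc hs h
  obtain ⟨hA1, hA2, hA3⟩ := hA
  obtain ⟨hB1, hB2, hB3⟩ := hB
  simp only at hA1 hA2 hA3 hB1 hB2 hB3
  have hdW : ∀ r k, W r k = 0 ∨ V r k = 0 := fun r k => (hd k).imp (fun h => h.1 r) (fun h => h.1 r)
  have hda : ∀ k, a k = 0 ∨ b k = 0 := fun k => (hd k).imp (fun h => h.2) (fun h => h.2)
  have hl2 : l2norm a ≤ 1 / lam → l2norm b ≤ 1 / lam → l2norm (c • a + s • b) ≤ 1 / lam := by
    intro h1 h2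
    rw [l2norm_le_iff' _ hC] at *
    simp only [Pi.add_apply, Pi.smul_apply, smul_eq_mul]
    rw [mix_sum' a b hda]
    nlinarith [sq_nonneg c, sq_nonneg s]
  refine ⟨?_, ?_⟩
  · ext l
    have : y l = c ^ 2 * y l + s ^ 2 * y l := by rw [← add_mul, h, one_mul]
    rw [this]
    nth_rewrite 1 [← hA1]
    rw [← hB1]
    simp only [nnOut_apply']
    rw [Finset.mul_sum, Finset.mul_sum, ← Finset.sum_add_distrib]
    refine Finset.sum_congr rfl fun k _ => ?_
    simp only [Matrix.add_apply, Matrix.smul_apply, Pi.add_apply, Pi.smul_apply, smul_eq_mul]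
    rcases hd k with ⟨h1, h2⟩ | ⟨h1, h2⟩
    · simp only [h1, h2, mul_zero, zero_add, mul_left_comm _ s, ← Finset.mul_sum,
        relu_mul_nonneg' hs]
      ring
    · simp only [h1, h2, mul_zero, add_zero, mul_left_comm _ c, ← Finset.mul_sum,
        relu_mul_nonneg' hc]
      ring
  · rcases hR with ⟨rfl, rfl⟩ | ⟨rfl, rfl⟩ | ⟨rfl, rfl⟩
    · rw [maxNorm_le_iff' _ hC] at *
      rw [linfNorm_le_iff' _ hC] at *
      exact ⟨fun i j => mix_abs' hc hs h (hdW i j) (hA2 i j) (hB2 i j),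
        fun j => mix_abs' hc hs h (hda j) (hA3 j) (hB3 j)⟩
    · refine ⟨?_, hl2 hA3 hB3⟩
      rw [frobNorm_le_iff' _ hC] at *
      simp only [Matrix.add_apply, Matrix.smul_apply, smul_eq_mul]
      simp only [mix_sum' _ _ (hdW _), Finset.sum_add_distrib, ← Finset.mul_sum]
      nlinarith [sq_nonneg c, sq_nonneg s]
    · exact ⟨mix_op' hC hc hs h W V (fun k => (hd k).imp (fun h => h.1) (fun h => h.1)) hA2 hB2,
        hl2 hA3 hB3⟩

/-! ### moving one neuron -/

/-- move coordinate `i` to `j` -/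
def mv' {m : ℕ} (i j : Fin m) (c s : ℝ) (a : Fin m → ℝ) : Fin m → ℝ :=
  fun k => if k = i then c * a i else if k = j then s * a i else a k

lemma sum_two' {m : ℕ} {i j : Fin m} (hij : i ≠ j) (f g : Fin m → ℝ)
    (h : f i + f j = g i + g j) (h' : ∀ k, k ≠ i → k ≠ j → f k = g k) :
    ∑ k, f k = ∑ k, g k := by
  rw [← sub_eq_zero, ← Finset.sum_sub_distrib,
    Fintype.sum_eq_add i j hij (fun k hk => by rw [h' k hk.1 hk.2, sub_self])]
  linarith

lemma mv_abs' {m : ℕ} {i j : Fin m} {c s C : ℝ} (hc : 0 ≤ c) (hs : 0 ≤ s) (h : c ^ 2 + s ^ 2 = 1)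
    (a : Fin m → ℝ) (ha : ∀ k, |a k| ≤ C) (k) : |mv' i j c s a k| ≤ C := by
  have hc1 : c ≤ 1 := by nlinarith
  have hs1 : s ≤ 1 := by nlinarith
  unfold mv'
  split_ifs
  · rw [abs_mul, abs_of_nonneg hc]
    nlinarith [abs_nonneg (a i), ha i]
  · rw [abs_mul, abs_of_nonneg hs]
    nlinarith [abs_nonneg (a i), ha i]
  · exact ha k

lemma mv_sum' {m : ℕ} {i j : Fin m} (hij : i ≠ j) {c s : ℝ} (h : c ^ 2 + s ^ 2 = 1)
    (a : Fin m → ℝ) (haj : a j = 0) : ∑ k, mv' i j c s a k ^ 2 = ∑ k, a k ^ 2 := by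
  apply sum_two' hij
  · simp only [mv', if_true, if_neg hij.symm, haj]
    linear_combination (a i) ^ 2 * h
  · intro k h1 h2
    simp [mv', h1, h2]

lemma mv_op' {d m : ℕ} {i j : Fin m} (hij : i ≠ j) {c s C : ℝ} (hC : 0 ≤ C)
    (h : c ^ 2 + s ^ 2 = 1) (W : Matrix (Fin d) (Fin m) ℝ) (hj : ∀ r, W r j = 0)
    (hW : opNorm W ≤ C) : opNorm (Matrix.of fun r => mv' i j c s (W r)) ≤ C := by
  rw [opNorm_le_iff' _ hC] at *
  intro v
  let u : Fin m → ℝ := fun k => if k = i then c * v i + s * v j else if k = j then 0 else v k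
  have e1 : (Matrix.of fun r => mv' i j c s (W r)).mulVec v = W.mulVec u := by
    ext r
    simp only [Matrix.mulVec, dotProduct, Matrix.of_apply]
    apply sum_two' hij
    · simp only [mv', u, if_true, if_neg hij.symm, hj]
      ring
    · intro k h1 h2
      simp [mv', u, h1, h2]
  have e2 : l2norm u ≤ l2norm v := by
    rw [l2norm_le_iff' _ (l2norm_nonneg' v), l2norm_sq']
    have : ∑ k, v k ^ 2 = ∑ k, (u k ^ 2 + if k = j then (c * v j - s * v i) ^ 2 else 0) := by
      apply sum_two' hij
      · simp only [u, if_true, if_neg hij.symm, if_neg hij]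
        linear_combination (-(v i) ^ 2 - (v j) ^ 2) * h
      · intro k h1 h2
        simp [u, h1, h2]
    rw [this]
    apply Finset.sum_le_sum
    intro k _
    split_ifs
    · nlinarith [sq_nonneg (c * v j - s * v i)]
    · simp
  rw [e1]
  exact (hW u).trans (mul_le_mul_of_nonneg_left e2 hC)

lemma mv_mem' {n d m : ℕ}
    (X : Matrix (Fin n) (Fin d) ℝ) (y : Fin n → ℝ)
    (lam : ℝ) (hlam : 0 < lam)
    (R : Matrix (Fin d) (Fin m) ℝ → ℝ) (Rv : (Fin m → ℝ) → ℝ)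
    (hR : (R = maxNorm ∧ Rv = linfNorm) ∨ (R = frobNorm ∧ Rv = l2norm) ∨
          (R = opNorm ∧ Rv = l2norm))
    (W : Matrix (Fin d) (Fin m) ℝ) (a : Fin m → ℝ)
    (hA : (W, a) ∈ solSet X y R Rv lam) {i j : Fin m} (hij : i ≠ j)
    (hj : ∀ r, W r j = 0) (haj : a j = 0) {c s : ℝ}
    (hc : 0 ≤ c) (hs : 0 ≤ s) (h : c ^ 2 + s ^ 2 = 1) :
    ((Matrix.of fun r => mv' i j c s (W r)), mv' i j c s a) ∈ solSet X y R Rv lam := by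
  have hC : 0 ≤ 1 / lam := by positivity
  obtain ⟨hA1, hA2, hA3⟩ := hA
  simp only at hA1 hA2 hA3
  have hl2 : l2norm a ≤ 1 / lam → l2norm (mv' i j c s a) ≤ 1 / lam := by
    intro h1
    rw [l2norm_le_iff' _ hC] at *
    rwa [mv_sum' hij h a haj]
  refine ⟨?_, ?_⟩
  · rw [← hA1]
    ext l
    simp only [nnOut_apply', Matrix.of_apply]
    apply sum_two' hij
    · simp only [mv', if_true, if_neg hij.symm, haj, mul_left_comm _ s, mul_left_comm _ c,
        ← Finset.mul_sum, relu_mul_nonneg' hs, relu_mul_nonneg' hc]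
      linear_combination (relu (∑ r, X l r * W r i) * a i) * h
    · intro k h1 h2
      simp [mv', h1, h2]
  · rcases hR with ⟨rfl, rfl⟩ | ⟨rfl, rfl⟩ | ⟨rfl, rfl⟩
    · rw [maxNorm_le_iff' _ hC] at *
      rw [linfNorm_le_iff' _ hC] at *
      exact ⟨fun r k => mv_abs' hc hs h (W r) (hA2 r) k, fun k => mv_abs' hc hs h a hA3 k⟩
    · refine ⟨?_, hl2 hA3⟩
      rw [frobNorm_le_iff' _ hC] at *
      simp only [Matrix.of_apply]
      simpa only [mv_sum' hij h (W _) (hj _)] using hA2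
    · exact ⟨mv_op' hij hC h W hj hA2, hl2 hA3⟩

lemma mv_joined' {n d m : ℕ}
    (X : Matrix (Fin n) (Fin d) ℝ) (y : Fin n → ℝ)
    (lam : ℝ) (hlam : 0 < lam)
    (R : Matrix (Fin d) (Fin m) ℝ → ℝ) (Rv : (Fin m → ℝ) → ℝ)
    (hR : (R = maxNorm ∧ Rv = linfNorm) ∨ (R = frobNorm ∧ Rv = l2norm) ∨
          (R = opNorm ∧ Rv = l2norm))
    (W : Matrix (Fin d) (Fin m) ℝ) (a : Fin m → ℝ)
    (hA : (W, a) ∈ solSet X y R Rv lam) {i j : Fin m} (hij : i ≠ j)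
    (hj : ∀ r, W r j = 0) (haj : a j = 0) :
    JoinedIn (solSet X y R Rv lam) (W, a)
      ((Matrix.of fun r => mv' i j 0 1 (W r)), mv' i j 0 1 a) := by
  have hcont : ∀ (b : Fin m → ℝ) k, Continuous fun p : ℝ × ℝ => mv' i j p.1 p.2 b k := by
    intro b k
    unfold mv'
    split_ifs <;> fun_prop
  have key := joinedIn_circle' (F := solSet X y R Rv lam)
    (fun c s => ((Matrix.of fun r => mv' i j c s (W r)), mv' i j c s a)) ?_
    (fun c s hc hs h => mv_mem' X y lam hlam R Rv hR W a hA hij hj haj hc hs h)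
  · have e : ∀ b : Fin m → ℝ, b j = 0 → mv' i j 1 0 b = b := by
      intro b hb
      ext k
      unfold mv'
      split_ifs with h1 h2
      · simp [h1]
      · simp [h2, hb]
      · rfl
    have e2 : (Matrix.of fun r => mv' i j 1 0 (W r)) = W := by
      ext r k
      exact congrFun (e (W r) (hj r)) k
    simp only [e a haj, e2] at key
    exact key
  · refine Continuous.prodMk ?_ ?_
    · exact continuous_matrix fun r k => hcont (W r) k
    · exact continuous_pi fun k => hcont a k

/-! ### zeroing the output weights of dead neurons -/

lemma zero_joined' {n d m : ℕ}
    (X : Matrix (Fin n) (Fin d) ℝ) (y : Fin n → ℝ)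
    (lam : ℝ) (hlam : 0 < lam)
    (R : Matrix (Fin d) (Fin m) ℝ → ℝ) (Rv : (Fin m → ℝ) → ℝ)
    (hR : (R = maxNorm ∧ Rv = linfNorm) ∨ (R = frobNorm ∧ Rv = l2norm) ∨
          (R = opNorm ∧ Rv = l2norm))
    (W : Matrix (Fin d) (Fin m) ℝ) (a : Fin m → ℝ)
    (hA : (W, a) ∈ solSet X y R Rv lam) (I : Finset (Fin m))
    (hI : ∀ k, k ∉ I → ∀ r, W r k = 0) :
    JoinedIn (solSet X y R Rv lam) (W, a) (W, fun k => if k ∈ I then a k else 0) := by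
  have hC : 0 ≤ 1 / lam := by positivity
  have key := joinedIn_circle' (F := solSet X y R Rv lam)
    (fun c _ => (W, fun k => if k ∈ I then a k else c * a k)) ?_ ?_
  · simpa using key
  · refine Continuous.prodMk continuous_const (continuous_pi fun k => ?_)
    split_ifs <;> fun_prop
  · intro c s hc hs h
    obtain ⟨hA1, hA2, hA3⟩ := hA
    simp only at hA1 hA2 hA3
    have hc1 : c ≤ 1 := by nlinarith
    have hab : ∀ k, |if k ∈ I then a k else c * a k| ≤ |a k| := by
      intro k
      split_ifs
      · rfl
      · rw [abs_mul, abs_of_nonneg hc]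
        nlinarith [abs_nonneg (a k)]
    have hl2 : l2norm a ≤ 1 / lam → l2norm (fun k => if k ∈ I then a k else c * a k) ≤ 1 / lam := by
      intro h1
      rw [l2norm_le_iff' _ hC] at *
      exact (Finset.sum_le_sum fun k _ => sq_le_sq.2 (hab k)).trans h1
    refine ⟨?_, hA2, ?_⟩
    · rw [← hA1]
      ext l
      simp only [nnOut_apply']
      refine Finset.sum_congr rfl fun k _ => ?_
      split_ifs with hk
      · rfl
      · simp [hI k hk, relu]
    · rcases hR with ⟨rfl, rfl⟩ | ⟨rfl, rfl⟩ | ⟨rfl, rfl⟩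
      · rw [linfNorm_le_iff' _ hC] at *
        exact fun k => (hab k).trans (hA3 k)
      · exact hl2 hA3
      · exact hl2 hA3

lemma main_joined' {n d m : ℕ}
    (X : Matrix (Fin n) (Fin d) ℝ) (y : Fin n → ℝ)
    (lam : ℝ) (hlam : 0 < lam)
    (R : Matrix (Fin d) (Fin m) ℝ → ℝ) (Rv : (Fin m → ℝ) → ℝ)
    (hR : (R = maxNorm ∧ Rv = linfNorm) ∨ (R = frobNorm ∧ Rv = l2norm) ∨
          (R = opNorm ∧ Rv = l2norm))
    (V : Matrix (Fin d) (Fin m) ℝ) (b : Fin m → ℝ)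
    (hB : (V, b) ∈ solSet X y R Rv lam) (J : Finset (Fin m))
    (hJ : ∀ k, k ∉ J → (∀ r, V r k = 0) ∧ b k = 0) (N : ℕ) :
    ∀ (W : Matrix (Fin d) (Fin m) ℝ) (a : Fin m → ℝ) (_ : (W, a) ∈ solSet X y R Rv lam)
      (I : Finset (Fin m)) (_ : ∀ k, k ∉ I → (∀ r, W r k = 0) ∧ a k = 0)
      (_ : I.card + J.card ≤ m) (_ : (I ∩ J).card = N),
    JoinedIn (solSet X y R Rv lam) (W, a) (V, b) := by
  induction N with
  | zero =>
    intro W a hA I hI hc hN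
    refine mix_joined' X y lam hlam R Rv hR W V a b hA hB fun k => ?_
    by_cases hk : k ∈ I
    · right
      refine hJ k fun hkJ => ?_
      rw [Finset.card_eq_zero] at hN
      have : k ∈ I ∩ J := Finset.mem_inter.2 ⟨hk, hkJ⟩
      simp [hN] at this
    · exact Or.inl (hI k hk)
  | succ N ih =>
    intro W a hA I hI hc hN
    obtain ⟨i, hi⟩ : (I ∩ J).Nonempty := by
      rw [← Finset.card_pos]; omega
    obtain ⟨hiI, hiJ⟩ := Finset.mem_inter.1 hi
    obtain ⟨j, hj⟩ : ∃ j, j ∉ I ∪ J := by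
      by_contra! hcon
      have h1 : I ∪ J = Finset.univ := Finset.eq_univ_iff_forall.2 hcon
      have h2 := Finset.card_union_add_card_inter I J
      rw [h1, Finset.card_univ, Fintype.card_fin] at h2
      omega
    simp only [Finset.mem_union, not_or] at hj
    obtain ⟨hjI, hjJ⟩ := hj
    have hij : i ≠ j := fun h => hjI (h ▸ hiI)
    have hjo := mv_joined' X y lam hlam R Rv hR W a hA hij (hI j hjI).1 (hI j hjI).2
    refine hjo.trans (ih _ _ hjo.target_mem (insert j (I.erase i)) ?_ ?_ ?_)
    · intro k hk
      simp only [Finset.mem_insert, Finset.mem_erase, not_or, not_and] at hk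
      by_cases hki : k = i
      · simp [mv', hki]
      · have := hI k (hk.2 hki)
        simp [mv', hki, hk.1, this.1, this.2]
    · rw [Finset.card_insert_of_notMem (by simp [hjI]), Finset.card_erase_of_mem hiI]
      have : 0 < I.card := Finset.card_pos.2 ⟨i, hiI⟩
      omega
    · rw [Finset.insert_inter_of_notMem hjJ, Finset.erase_inter, Finset.card_erase_of_mem hi, hN]
      rfl

/-- paths between sparse solutions inside the regularized solution set. -/
theorem path_between_sparse_solutions {n d m : ℕ}
    (X : Matrix (Fin n) (Fin d) ℝ) (y : Fin n → ℝ)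
    (lam : ℝ) (hlam : 0 < lam)
    (mstar : ℕ) (hmstar : 0 < mstar) (hm : mstar ≤ m)
    (R : Matrix (Fin d) (Fin m) ℝ → ℝ) (Rv : (Fin m → ℝ) → ℝ)
    (hR : (R = maxNorm ∧ Rv = linfNorm) ∨ (R = frobNorm ∧ Rv = l2norm) ∨
          (R = opNorm ∧ Rv = l2norm))
    (S : Set (Matrix (Fin d) (Fin m) ℝ × (Fin m → ℝ)))
    (hS : S ⊆ solSet X y R Rv lam)
    (hsparse : ∀ p ∈ S, 2 * Set.ncard {i : Fin m | mcol p.1 i ≠ 0} ≤ mstar) :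
    ∀ A ∈ S, ∀ B ∈ S, JoinedIn (solSet X y R Rv lam) A B := by
  classical
  have key : ∀ p ∈ S, ∃ I : Finset (Fin m), 2 * I.card ≤ mstar ∧
      ∀ k, k ∉ I → ∀ r, p.1 r k = 0 := by
    intro p hp
    refine ⟨Finset.univ.filter fun i => mcol p.1 i ≠ 0, ?_, ?_⟩
    · have := hsparse p hp
      rwa [← Set.ncard_coe_finset, Finset.coe_filter_univ]
    · intro k hk r
      simp only [Finset.mem_filter, Finset.mem_univ, true_and, not_not] at hk
      exact congrFun hk r
  rintro ⟨W, a⟩ hA ⟨V, b⟩ hB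
  obtain ⟨I, hI1, hI2⟩ := key _ hA
  obtain ⟨J, hJ1, hJ2⟩ := key _ hB
  have jA := zero_joined' X y lam hlam R Rv hR W a (hS hA) I hI2
  have jB := zero_joined' X y lam hlam R Rv hR V b (hS hB) J hJ2
  refine jA.trans (JoinedIn.trans ?_ jB.symm)
  refine main_joined' X y lam hlam R Rv hR V _ jB.target_mem J ?_ _ W _ jA.target_mem I ?_ ?_ rfl
  · intro k hk
    exact ⟨hJ2 k hk, by simp [hk]⟩
  · intro k hk
    exact ⟨hI2 k hk, by simp [hk]⟩
  · omega
end

section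
/- Let R ∈ {Frobenius norm ‖·‖_F, operator norm ‖·‖_op} and suppose the width satisfies m ≥ 4P, where P is the number of distinct hyperplane arrangement patterns 1(Xh ≥ 0) as h ranges over ℝ^d. Then for any two points A, B ∈ O_R(λ) there exists a continuous path γ : [0,1] → O_R(λ) with γ(0) = A and γ(1) = B; that is, the regularized solution set O_R(λ) is path-connected. -/
open scoped BigOperators

/-- quadratic constraints -/
def gcons {d m : ℕ} (Q : Set (Finset (Fin d → ℝ) × ℝ)) (W : Matrix (Fin d) (Fin m) ℝ) : Prop :=
  ∀ F ∈ Q, ∑ x ∈ F.1, ∑ i, (∑ r, x r * W r i) ^ 2 ≤ F.2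

/-- abstract solution set -/
def gset {n d m : ℕ} (X : Matrix (Fin n) (Fin d) ℝ) (y : Fin n → ℝ)
    (Q : Set (Finset (Fin d → ℝ) × ℝ)) (c : ℝ) : Set (Matrix (Fin d) (Fin m) ℝ × (Fin m → ℝ)) :=
  {p | (∀ k, ∑ i, relu (∑ r, X k r * p.1 r i) * p.2 i = y k) ∧ gcons Q p.1 ∧ ∑ i, p.2 i ^ 2 ≤ c}

lemma relu_smul' {c : ℝ} (hc : 0 ≤ c) (x : ℝ) : relu (c * x) = c * relu x := by
  unfold relu
  rw [mul_max_of_nonneg _ _ hc, mul_zero]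

lemma gset_scaled {n d m : ℕ} (X : Matrix (Fin n) (Fin d) ℝ) (y : Fin n → ℝ)
    (Q : Set (Finset (Fin d → ℝ) × ℝ)) (c : ℝ) (V : Fin m → Fin d → ℝ) (b p : Fin m → ℝ)
    (hp : ∀ i, 0 ≤ p i) :
    ((fun r i => p i * V i r, fun i => p i * b i) : Matrix (Fin d) (Fin m) ℝ × (Fin m → ℝ))
      ∈ gset X y Q c ↔
    (∀ k, ∑ i, p i ^ 2 * (relu (∑ r, X k r * V i r) * b i) = y k) ∧
    (∀ F ∈ Q, ∑ i, p i ^ 2 * ∑ x ∈ F.1, (∑ r, x r * V i r) ^ 2 ≤ F.2) ∧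
    ∑ i, p i ^ 2 * b i ^ 2 ≤ c := by
  unfold gset gcons
  simp only [Set.mem_ofPred_eq]
  have h1 : ∀ k i, relu (∑ r, X k r * (p i * V i r)) * (p i * b i)
      = p i ^ 2 * (relu (∑ r, X k r * V i r) * b i) := by
    intro k i
    have : ∑ r, X k r * (p i * V i r) = p i * ∑ r, X k r * V i r := by
      rw [Finset.mul_sum]; exact Finset.sum_congr rfl fun r _ => by ring
    rw [this, relu_smul' (hp i)]; ring
  have h2 : ∀ F : Finset (Fin d → ℝ), ∑ x ∈ F, ∑ i, (∑ r, x r * (p i * V i r)) ^ 2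
      = ∑ i, p i ^ 2 * ∑ x ∈ F, (∑ r, x r * V i r) ^ 2 := by
    intro F
    rw [Finset.sum_comm]
    refine Finset.sum_congr rfl fun i _ => ?_
    rw [Finset.mul_sum]
    refine Finset.sum_congr rfl fun x _ => ?_
    have : ∑ r, x r * (p i * V i r) = p i * ∑ r, x r * V i r := by
      rw [Finset.mul_sum]; exact Finset.sum_congr rfl fun r _ => by ring
    rw [this]; ring
  simp only [h1, h2, mul_pow]

lemma op2 {n d m : ℕ} (X : Matrix (Fin n) (Fin d) ℝ) (y : Fin n → ℝ)
    (Q : Set (Finset (Fin d → ℝ) × ℝ)) (c : ℝ)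
    (A B : Matrix (Fin d) (Fin m) ℝ × (Fin m → ℝ)) (hA : A ∈ gset X y Q c) (hB : B ∈ gset X y Q c)
    (h : ∀ i, ∃ (v : Fin d → ℝ) (b p q : ℝ), 0 ≤ p ∧ 0 ≤ q ∧ (∀ r, A.1 r i = p * v r) ∧
      A.2 i = p * b ∧ (∀ r, B.1 r i = q * v r) ∧ B.2 i = q * b) :
    JoinedIn (gset X y Q c) A B := by
  choose V b p q hp hq h1 h2 h3 h4 using h
  have eA : A = ((fun r i => p i * V i r, fun i => p i * b i) :
      Matrix (Fin d) (Fin m) ℝ × (Fin m → ℝ)) := by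
    refine Prod.ext ?_ ?_
    · funext r i; exact h1 i r
    · funext i; exact h2 i
  have eB : B = ((fun r i => q i * V i r, fun i => q i * b i) :
      Matrix (Fin d) (Fin m) ℝ × (Fin m → ℝ)) := by
    refine Prod.ext ?_ ?_
    · funext r i; exact h3 i r
    · funext i; exact h4 i
  rw [eA, gset_scaled X y Q c V b p hp] at hA
  rw [eB, gset_scaled X y Q c V b q hq] at hB
  rw [eA, eB]
  refine JoinedIn.ofLine (f := fun t : ℝ =>
    ((fun r i => √((1 - t) * p i ^ 2 + t * q i ^ 2) * V i r,
      fun i => √((1 - t) * p i ^ 2 + t * q i ^ 2) * b i) :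
      Matrix (Fin d) (Fin m) ℝ × (Fin m → ℝ))) ?_ ?_ ?_ ?_
  · refine Continuous.continuousOn (Continuous.prodMk ?_ ?_)
    · refine continuous_pi fun r => continuous_pi fun i => ?_
      fun_prop
    · refine continuous_pi fun i => ?_
      fun_prop
  · simp [Real.sqrt_sq, hp]
  · simp [Real.sqrt_sq, hq]
  · rintro _ ⟨t, ⟨ht0, ht1⟩, rfl⟩
    rw [gset_scaled X y Q c V b _ (fun i => Real.sqrt_nonneg _)]
    have hs : ∀ i, √((1 - t) * p i ^ 2 + t * q i ^ 2) ^ 2 = (1 - t) * p i ^ 2 + t * q i ^ 2 := by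
      intro i
      apply Real.sq_sqrt
      have : 0 ≤ 1 - t := by linarith
      positivity
    have key : ∀ f : Fin m → ℝ, ∑ i, √((1 - t) * p i ^ 2 + t * q i ^ 2) ^ 2 * f i
        = (1 - t) * ∑ i, p i ^ 2 * f i + t * ∑ i, q i ^ 2 * f i := by
      intro f
      rw [Finset.mul_sum, Finset.mul_sum, ← Finset.sum_add_distrib]
      exact Finset.sum_congr rfl fun i _ => by rw [hs]; ring
    simp only [key]
    refine ⟨fun k => ?_, fun F hF => ?_, ?_⟩
    · rw [hA.1 k, hB.1 k]; ring
    · nlinarith [hA.2.1 F hF, hB.2.1 F hF]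
    · nlinarith [hA.2.2, hB.2.2]

lemma join_supp {n d m : ℕ} (X : Matrix (Fin n) (Fin d) ℝ) (y : Fin n → ℝ)
    (Q : Set (Finset (Fin d → ℝ) × ℝ)) (c : ℝ)
    (A : Matrix (Fin d) (Fin m) ℝ × (Fin m → ℝ)) (hA : A ∈ gset X y Q c)
    (SA : Finset (Fin m)) (hSA : ∀ i ∉ SA, (∀ r, A.1 r i = 0) ∧ A.2 i = 0) (k : ℕ) :
    ∀ (B : Matrix (Fin d) (Fin m) ℝ × (Fin m → ℝ)) (_ : B ∈ gset X y Q c)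
      (SB : Finset (Fin m)) (_ : ∀ i ∉ SB, (∀ r, B.1 r i = 0) ∧ B.2 i = 0)
      (_ : SA.card + SB.card ≤ m) (_ : (SA ∩ SB).card = k),
    JoinedIn (gset X y Q c) A B := by
  induction k with
  | zero =>
    intro B hB SB hSB hc h0
    apply op2 X y Q c A B hA hB
    intro i
    by_cases hi : i ∈ SA
    · have hi' : i ∉ SB := by
        intro h'
        rw [Finset.card_eq_zero] at h0
        have : i ∈ SA ∩ SB := Finset.mem_inter.2 ⟨hi, h'⟩
        simp [h0] at this
      refine ⟨fun r => A.1 r i, A.2 i, 1, 0, by simp, by simp, by simp, by simp, ?_, ?_⟩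
      · simpa using (hSB i hi').1
      · simpa using (hSB i hi').2
    · refine ⟨fun r => B.1 r i, B.2 i, 0, 1, by simp, by simp, ?_, ?_, by simp, by simp⟩
      · simpa using (hSA i hi).1
      · simpa using (hSA i hi).2
  | succ k ih =>
    intro B hB SB hSB hc hk
    have hu := Finset.card_union_add_card_inter SA SB
    obtain ⟨i, hi⟩ : (SA ∩ SB).Nonempty := by rw [← Finset.card_pos]; omega
    obtain ⟨hiA, hiB⟩ := Finset.mem_inter.1 hi
    obtain ⟨j, hj⟩ : ∃ j, j ∉ SA ∪ SB := by
      by_contra! hcon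
      have : SA ∪ SB = Finset.univ := by ext j; simpa using hcon j
      rw [this, Finset.card_univ, Fintype.card_fin] at hu
      omega
    have hjA : j ∉ SA := fun h => hj (Finset.mem_union_left _ h)
    have hjB : j ∉ SB := fun h => hj (Finset.mem_union_right _ h)
    have hij : i ≠ j := fun h => hjA (h ▸ hiA)
    let σ := Equiv.swap i j
    let B' : Matrix (Fin d) (Fin m) ℝ × (Fin m → ℝ) := (fun r l => B.1 r (σ l), fun l => B.2 (σ l))
    have hB' : B' ∈ gset X y Q c := by
      obtain ⟨b1, b2, b3⟩ := hB
      refine ⟨fun k => ?_, fun F hF => ?_, ?_⟩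
      · rw [← b1 k]
        exact Equiv.sum_comp σ (fun i => relu (∑ r, X k r * B.1 r i) * B.2 i)
      · refine le_trans (le_of_eq ?_) (b2 F hF)
        refine Finset.sum_congr rfl fun x _ => ?_
        exact Equiv.sum_comp σ (fun i => (∑ r, x r * B.1 r i) ^ 2)
      · refine le_trans (le_of_eq ?_) b3
        exact Equiv.sum_comp σ (fun i => B.2 i ^ 2)
    have hB'supp : ∀ l ∉ insert j (SB.erase i), (∀ r, B'.1 r l = 0) ∧ B'.2 l = 0 := by
      intro l hl
      have hlj : l ≠ j := fun h => hl (by simp [h])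
      by_cases hli : l = i
      · have : σ l = j := by simp [σ, hli]
        simp only [B', this]
        exact hSB j hjB
      · have : σ l = l := Equiv.swap_apply_of_ne_of_ne hli hlj
        simp only [B', this]
        exact hSB l (fun h => hl (by simp [h, hli]))
    have hjoin : JoinedIn (gset X y Q c) B' B := by
      apply op2 X y Q c B' B hB' hB
      intro l
      by_cases hli : l = i
      · have : σ l = j := by simp [σ, hli]
        refine ⟨fun r => B.1 r l, B.2 l, 0, 1, by simp, by simp, ?_, ?_, by simp, by simp⟩
        · simpa [B', this] using (hSB j hjB).1
        · simpa [B', this] using (hSB j hjB).2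
      by_cases hlj : l = j
      · subst hlj
        refine ⟨fun r => B'.1 r l, B'.2 l, 1, 0, by simp, by simp, by simp, by simp, ?_, ?_⟩
        · simpa using (hSB l hjB).1
        · simpa using (hSB l hjB).2
      · have : σ l = l := Equiv.swap_apply_of_ne_of_ne hli hlj
        refine ⟨fun r => B.1 r l, B.2 l, 1, 1, by simp, by simp, ?_, ?_, by simp, by simp⟩
        · simp [B', this]
        · simp [B', this]
    refine JoinedIn.trans (ih B' hB' (insert j (SB.erase i)) hB'supp ?_ ?_) hjoin
    · rw [Finset.card_insert_of_notMem (by simp [hjB]), Finset.card_erase_of_mem hiB]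
      have : 0 < SB.card := Finset.card_pos.2 ⟨i, hiB⟩
      omega
    · have : SA ∩ insert j (SB.erase i) = (SA ∩ SB).erase i := by
        ext l
        simp only [Finset.mem_inter, Finset.mem_insert, Finset.mem_erase]
        constructor
        · rintro ⟨a, rfl | b⟩
          · exact absurd a hjA
          · exact ⟨b.1, a, b.2⟩
        · rintro ⟨a, b, e⟩
          exact ⟨b, Or.inr ⟨a, e⟩⟩
      rw [this, Finset.card_erase_of_mem hi, hk]; rfl

lemma relu_sum' {ι : Type*} (T : Finset ι) (w z : ι → ℝ) (hw : ∀ j ∈ T, 0 ≤ w j)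
    (hz : (∀ j ∈ T, w j ≠ 0 → 0 ≤ z j) ∨ (∀ j ∈ T, w j ≠ 0 → z j ≤ 0)) :
    relu (∑ j ∈ T, w j * z j) = ∑ j ∈ T, w j * relu (z j) := by
  unfold relu
  rcases hz with hz | hz
  · rw [max_eq_left]
    · refine Finset.sum_congr rfl fun j hj => ?_
      by_cases h : w j = 0
      · simp [h]
      · rw [max_eq_left (hz j hj h)]
    · refine Finset.sum_nonneg fun j hj => ?_
      by_cases h : w j = 0
      · simp [h]
      · exact mul_nonneg (hw j hj) (hz j hj h)
  · rw [max_eq_right]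
    · symm
      refine Finset.sum_eq_zero fun j hj => ?_
      by_cases h : w j = 0
      · simp [h]
      · rw [max_eq_right (hz j hj h), mul_zero]
    · refine Finset.sum_nonpos fun j hj => ?_
      by_cases h : w j = 0
      · simp [h]
      · exact mul_nonpos_of_nonneg_of_nonpos (hw j hj) (hz j hj h)

lemma proj_contr {m : ℕ} {K : Type*} [Fintype K] [DecidableEq K] (g : Fin m → K) (a : Fin m → ℝ)
    (ρ : Fin m → ℝ) :
    ∑ i, (a i / (∑ j with g j = g i, a j ^ 2) * ∑ j with g j = g i, a j * ρ j) ^ 2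
      ≤ ∑ i, ρ i ^ 2 := by
  rw [← Finset.sum_fiberwise Finset.univ g, ← Finset.sum_fiberwise Finset.univ g (fun i => ρ i ^ 2)]
  refine Finset.sum_le_sum fun κ _ => ?_
  set s := ∑ j with g j = κ, a j ^ 2 with hs
  set T := ∑ j with g j = κ, a j * ρ j with hT
  have e : ∑ i with g i = κ, (a i / (∑ j with g j = g i, a j ^ 2) * ∑ j with g j = g i, a j * ρ j) ^ 2
      = s * (T / s) ^ 2 := by
    rw [hs, Finset.sum_mul]
    refine Finset.sum_congr rfl fun i hi => ?_
    have : g i = κ := by simpa using hi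
    rw [this]; ring
  rw [e]
  have cs : T ^ 2 ≤ s * ∑ j with g j = κ, ρ j ^ 2 := Finset.sum_mul_sq_le_sq_mul_sq _ _ _
  have s0 : 0 ≤ s := Finset.sum_nonneg fun _ _ => sq_nonneg _
  have r0 : 0 ≤ ∑ j with g j = κ, ρ j ^ 2 := Finset.sum_nonneg fun _ _ => sq_nonneg _
  rcases s0.eq_or_lt with h | h
  · rw [← h]; simpa using r0
  · have : s * (T / s) ^ 2 = T ^ 2 / s := by field_simp
    rw [this, div_le_iff₀ h]; linarith

lemma step1 {n d m : ℕ} {K : Type*} [Fintype K] [DecidableEq K]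
    (X : Matrix (Fin n) (Fin d) ℝ) (y : Fin n → ℝ)
    (Q : Set (Finset (Fin d → ℝ) × ℝ)) (c : ℝ)
    (W : Matrix (Fin d) (Fin m) ℝ) (a : Fin m → ℝ) (hA : (W, a) ∈ gset X y Q c)
    (g : Fin m → K) (hsgn : ∀ i j, g i = g j → 0 ≤ a i * a j)
    (hz : ∀ k κ, (∀ i, g i = κ → 0 ≤ ∑ r, X k r * W r i) ∨
      (∀ i, g i = κ → ∑ r, X k r * W r i ≤ 0)) :
    JoinedIn (gset X y Q c) (W, a)
      (fun r i => a i / (∑ j with g j = g i, a j ^ 2) * ∑ j with g j = g i, a j * W r j, a) := by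
  obtain ⟨h1, h2, h3⟩ := hA
  simp only at h1 h2 h3
  set s : K → ℝ := fun κ => ∑ j with g j = κ, a j ^ 2 with hs
  have s0 : ∀ κ, 0 ≤ s κ := fun κ => Finset.sum_nonneg fun _ _ => sq_nonneg _
  have sa : ∀ i, s (g i) = 0 → a i = 0 := by
    intro i hi
    have := (Finset.sum_eq_zero_iff_of_nonneg (fun j _ => sq_nonneg (a j))).1 hi i (by simp)
    simpa using this
  let M : ℝ → Fin m → Fin m → ℝ := fun t i j =>
    (1 - t) * (if i = j then 1 else 0) + t * (if g j = g i then a i * a j / s (g i) else 0)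
  have hM : ∀ t i (f : Fin m → ℝ), ∑ j, M t i j * f j
      = (1 - t) * f i + t * (a i / s (g i) * ∑ j with g j = g i, a j * f j) := by
    intro t i f
    simp only [M, add_mul, Finset.sum_add_distrib]
    congr 1
    · simp
    · rw [Finset.mul_sum, Finset.mul_sum, Finset.sum_filter]
      refine Finset.sum_congr rfl fun j _ => ?_
      split_ifs
      · ring
      · ring
  have hlin : ∀ t i (x : Fin d → ℝ), ∑ r, x r * ((1 - t) * W r i + t * (a i / s (g i) *
      ∑ j with g j = g i, a j * W r j)) = ∑ j, M t i j * ∑ r, x r * W r j := by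
    intro t i x
    simp only [← hM]
    simp only [Finset.mul_sum]
    rw [Finset.sum_comm]
    exact Finset.sum_congr rfl fun _ _ => Finset.sum_congr rfl fun _ _ => by ring
  refine JoinedIn.ofLine (f := fun t : ℝ =>
    ((fun r i => (1 - t) * W r i + t * (a i / s (g i) * ∑ j with g j = g i, a j * W r j), a) :
      Matrix (Fin d) (Fin m) ℝ × (Fin m → ℝ))) ?_ ?_ ?_ ?_
  · refine Continuous.continuousOn (Continuous.prodMk ?_ continuous_const)
    refine continuous_pi fun r => continuous_pi fun i => ?_
    fun_prop
  · simp
  · simp [hs]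
  · rintro _ ⟨t, ⟨ht0, ht1⟩, rfl⟩
    have ht1' : 0 ≤ 1 - t := by linarith
    refine ⟨fun k => ?_, fun F hF => ?_, h3⟩
    · simp only [hlin t _ (X k)]
      rw [← h1 k]
      have hr : ∀ i, relu (∑ j, M t i j * ∑ r, X k r * W r j)
          = ∑ j, M t i j * relu (∑ r, X k r * W r j) := by
        intro i
        refine relu_sum' _ _ _ (fun j _ => ?_) ?_
        · simp only [M]
          refine add_nonneg (mul_nonneg ht1' (by split_ifs <;> norm_num)) (mul_nonneg ht0 ?_)
          split_ifs with h
          · exact div_nonneg (hsgn i j h.symm) (s0 _)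
          · exact le_rfl
        · have hne : ∀ j, M t i j ≠ 0 → g j = g i := by
            intro j hj
            by_contra hcon
            apply hj
            have : i ≠ j := fun h => hcon (by rw [h])
            simp [M, this, hcon]
          rcases hz k (g i) with h | h
          · exact Or.inl fun j _ hj => h j (hne j hj)
          · exact Or.inr fun j _ hj => h j (hne j hj)
      simp only [hr, Finset.sum_mul]
      rw [Finset.sum_comm]
      refine Finset.sum_congr rfl fun j _ => ?_
      have hMs : ∀ i, M t i j = M t j i := by
        intro i
        simp only [M]
        congr 2
        · simp [eq_comm]
        · by_cases h : g j = g i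
          · simp [h, mul_comm]
          · simp [h, Ne.symm h]
      have : ∑ i, M t i j * a i = a j := by
        simp only [hMs]
        rw [hM]
        have e : ∑ l with g l = g j, a l * a l = s (g j) := by
          simp [hs, sq]
        rw [e]
        by_cases h : s (g j) = 0
        · simp [sa j h]
        · field_simp; ring
      calc ∑ i, M t i j * relu (∑ r, X k r * W r j) * a i
          = relu (∑ r, X k r * W r j) * ∑ i, M t i j * a i := by
            rw [Finset.mul_sum]; exact Finset.sum_congr rfl fun _ _ => by ring
        _ = _ := by rw [this]
    · refine le_trans (Finset.sum_le_sum fun x _ => ?_) (h2 F hF)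
      simp only [hlin t _ x]
      simp only [hM]
      set ρ : Fin m → ℝ := fun j => ∑ r, x r * W r j with hρ
      have pc := proj_contr g a ρ
      calc ∑ i, ((1 - t) * ρ i + t * (a i / s (g i) * ∑ j with g j = g i, a j * ρ j)) ^ 2
          ≤ ∑ i, ((1 - t) * ρ i ^ 2 + t * (a i / s (g i) * ∑ j with g j = g i, a j * ρ j) ^ 2) := by
            refine Finset.sum_le_sum fun i _ => ?_
            generalize a i / s (g i) * ∑ j with g j = g i, a j * ρ j = q
            nlinarith [mul_nonneg (mul_nonneg ht0 ht1') (sq_nonneg (ρ i - q))]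
        _ = (1 - t) * ∑ i, ρ i ^ 2 +
            t * ∑ i, (a i / s (g i) * ∑ j with g j = g i, a j * ρ j) ^ 2 := by
            rw [Finset.sum_add_distrib, Finset.mul_sum, Finset.mul_sum]
        _ ≤ (1 - t) * ∑ i, ρ i ^ 2 + t * ∑ i, ρ i ^ 2 := by
            have := mul_le_mul_of_nonneg_left pc ht0
            linarith
        _ = ∑ i, ρ i ^ 2 := by ring

lemma step2 {n d m : ℕ} {K : Type*} [Fintype K] [DecidableEq K]
    (X : Matrix (Fin n) (Fin d) ℝ) (y : Fin n → ℝ)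
    (Q : Set (Finset (Fin d → ℝ) × ℝ)) (c : ℝ)
    (W : Matrix (Fin d) (Fin m) ℝ) (a : Fin m → ℝ)
    (g : Fin m → K) (ε : K → ℝ) (hε : ∀ i, a i = ε (g i) * |a i|) (u : K → Fin d → ℝ)
    (hW : ∀ r i, W r i = a i / (∑ j with g j = g i, a j ^ 2) * u (g i) r)
    (hA : (W, a) ∈ gset X y Q c) :
    ∃ B ∈ gset X y Q c, JoinedIn (gset X y Q c) (W, a) B ∧
      ∃ S : Finset (Fin m), S.card ≤ (Finset.univ.image g).card ∧
        ∀ i ∉ S, (∀ r, B.1 r i = 0) ∧ B.2 i = 0 := by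
  set s : K → ℝ := fun κ => ∑ j with g j = κ, a j ^ 2 with hs
  have s0 : ∀ κ, 0 ≤ s κ := fun κ => Finset.sum_nonneg fun _ _ => sq_nonneg _
  have sa : ∀ i, s (g i) = 0 → a i = 0 := by
    intro i hi
    have := (Finset.sum_eq_zero_iff_of_nonneg (fun j _ => sq_nonneg (a j))).1 hi i (by simp)
    simpa using this
  rcases isEmpty_or_nonempty (Fin m) with hem | hne
  · exact ⟨(W, a), hA, JoinedIn.refl hA, ∅, by simp, fun i => (hem.false i).elim⟩
  let φ : K → Fin m := Function.invFun g
  have hφ : ∀ i, g (φ (g i)) = g i := fun i => Function.invFun_eq ⟨i, rfl⟩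
  let V : K → Fin d → ℝ := fun κ r => ε κ / √(s κ) * u κ r
  let b : K → ℝ := fun κ => ε κ * √(s κ)
  let p : Fin m → ℝ := fun i => |a i| / √(s (g i))
  let q : Fin m → ℝ := fun i => if i = φ (g i) then 1 else 0
  have hp : ∀ i, 0 ≤ p i := fun i => by positivity
  have hq : ∀ i, 0 ≤ q i := fun i => by simp only [q]; split_ifs <;> norm_num
  have e1 : ∀ r i, W r i = p i * V (g i) r := by
    intro r i
    have : p i * V (g i) r = (ε (g i) * |a i|) / (√(s (g i)) * √(s (g i))) * u (g i) r := by
      simp only [p, V]; ring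
    rw [this, ← hε, Real.mul_self_sqrt (s0 _)]
    exact hW r i
  have e2 : ∀ i, a i = p i * b (g i) := by
    intro i
    by_cases h : s (g i) = 0
    · simp [p, sa i h]
    · have h' : √(s (g i)) ≠ 0 := by rw [Real.sqrt_ne_zero (s0 _)]; exact h
      have : p i * b (g i) = ε (g i) * |a i| := by
        simp only [p, b]; field_simp
      rw [this]; exact hε i
  have key : ∀ F : K → ℝ, (∀ κ, s κ = 0 → F κ = 0) →
      ∑ i, q i ^ 2 * F (g i) = ∑ i, p i ^ 2 * F (g i) := by
    intro F hF
    rw [← Finset.sum_fiberwise Finset.univ g,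
      ← Finset.sum_fiberwise Finset.univ g (fun i => p i ^ 2 * F (g i))]
    refine Finset.sum_congr rfl fun κ _ => ?_
    have hf : ∀ w : Fin m → ℝ, ∑ i with g i = κ, w i * F (g i) = (∑ i with g i = κ, w i) * F κ := by
      intro w
      rw [Finset.sum_mul]
      refine Finset.sum_congr rfl fun i hi => ?_
      rw [(Finset.mem_filter.1 hi).2]
    rw [hf (fun i => q i ^ 2), hf (fun i => p i ^ 2)]
    by_cases h : s κ = 0
    · rw [hF κ h]; simp
    · congr 1
      have hpp : ∑ i with g i = κ, p i ^ 2 = 1 := by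
        have : ∑ i with g i = κ, p i ^ 2 = s κ / s κ := by
          conv_rhs => rw [hs]
          simp only []
          rw [Finset.sum_div]
          refine Finset.sum_congr rfl fun i hi => ?_
          simp only [p]
          rw [(Finset.mem_filter.1 hi).2, div_pow, sq_abs, Real.sq_sqrt (s0 κ)]
        rw [this, div_self h]
      rw [hpp]
      have hex : ∃ i, g i = κ := by
        by_contra! hcon
        exact h (Finset.sum_eq_zero fun i hi => absurd (Finset.mem_filter.1 hi).2 (hcon i))
      have hgk : g (φ κ) = κ := Function.invFun_eq hex
      rw [Finset.sum_eq_single (φ κ)]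
      · simp [q, hgk]
      · intro i hi hne
        have := (Finset.mem_filter.1 hi).2
        simp [q, this, hne]
      · intro h; simp [hgk] at h
  have eA : (W, a) = ((fun r i => p i * V (g i) r, fun i => p i * b (g i)) :
      Matrix (Fin d) (Fin m) ℝ × (Fin m → ℝ)) := by
    refine Prod.ext ?_ ?_
    · funext r i; exact e1 r i
    · funext i; exact e2 i
  let B : Matrix (Fin d) (Fin m) ℝ × (Fin m → ℝ) :=
    (fun r i => q i * V (g i) r, fun i => q i * b (g i))
  have hb0 : ∀ κ, s κ = 0 → b κ = 0 := fun κ h => by simp [b, h]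
  have hV0 : ∀ κ, s κ = 0 → ∀ r, V κ r = 0 := fun κ h r => by simp [V, h]
  have hB : B ∈ gset X y Q c := by
    have hA' := hA
    rw [eA, gset_scaled X y Q c (fun i => V (g i)) (fun i => b (g i)) p hp] at hA'
    refine (gset_scaled X y Q c (fun i => V (g i)) (fun i => b (g i)) q hq).2 ⟨fun k => ?_, fun F hF => ?_, ?_⟩
    · rw [← hA'.1 k]
      exact key (fun κ => relu (∑ r, X k r * V κ r) * b κ) (fun κ h => by simp [hb0 κ h])
    · refine le_trans (le_of_eq ?_) (hA'.2.1 F hF)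
      exact key (fun κ => ∑ x ∈ F.1, (∑ r, x r * V κ r) ^ 2) (fun κ h => by simp [hV0 κ h])
    · refine le_trans (le_of_eq ?_) hA'.2.2
      exact key (fun κ => b κ ^ 2) (fun κ h => by simp [hb0 κ h])
  refine ⟨B, hB, ?_, (Finset.univ.image g).image φ, Finset.card_image_le, ?_⟩
  · apply op2 X y Q c _ _ hA hB
    intro i
    exact ⟨V (g i), b (g i), p i, q i, hp i, hq i, fun r => e1 r i, e2 i, fun r => rfl, rfl⟩
  · intro i hi
    have : q i = 0 := by
      simp only [q]
      rw [if_neg]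
      intro h
      apply hi
      rw [h]
      exact Finset.mem_image_of_mem _ (Finset.mem_image_of_mem _ (Finset.mem_univ _))
    simp [B, this]

lemma reduce {n d m : ℕ} 
    (X : Matrix (Fin n) (Fin d) ℝ) (y : Fin n → ℝ)
    (Q : Set (Finset (Fin d → ℝ) × ℝ)) (c : ℝ)
    (A : Matrix (Fin d) (Fin m) ℝ × (Fin m → ℝ)) (hA : A ∈ gset X y Q c) :
    ∃ B ∈ gset X y Q c, JoinedIn (gset X y Q c) A B ∧
      ∃ S : Finset (Fin m), S.card ≤ 2 * Set.ncard (Set.range (pattern X)) ∧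
        ∀ i ∉ S, (∀ r, B.1 r i = 0) ∧ B.2 i = 0 := by
  classical
  obtain ⟨W, a⟩ := A
  let g : Fin m → (Fin n → Bool) × Bool := fun i => (pattern X (fun r => W r i), decide (0 ≤ a i))
  have hε : ∀ i, a i = (fun κ : (Fin n → Bool) × Bool => if κ.2 then (1 : ℝ) else -1) (g i) * |a i| := by
    intro i
    by_cases h : 0 ≤ a i
    · simp [g, h, abs_of_nonneg]
    · simp [g, h, abs_of_neg (not_le.1 h)]
  have j1 := step1 X y Q c W a hA g ?_ ?_
  · obtain ⟨B, hB, hj, S, hS, hS'⟩ := step2 X y Q c _ a g (fun κ => if κ.2 then 1 else -1) hε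
      (fun κ r => ∑ j with g j = κ, a j * W r j) (fun r i => rfl) j1.target_mem
    · refine ⟨B, hB, j1.trans hj, S, hS.trans ?_, hS'⟩
      have hfin : (Set.range (pattern X)).Finite := Set.toFinite _
      have hsub : Finset.univ.image g ⊆ hfin.toFinset ×ˢ (Finset.univ : Finset Bool) := by
        intro κ hκ
        obtain ⟨i, -, rfl⟩ := Finset.mem_image.1 hκ
        simp [g, le_or_gt]
      have := Finset.card_le_card hsub
      rw [Finset.card_product, ← Set.ncard_eq_toFinset_card _ hfin] at this
      simp at this
      omega
  · intro i j hij
    have h2 := congrArg Prod.snd hij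
    simp only [g, decide_eq_decide] at h2
    by_cases h : 0 ≤ a i
    · exact mul_nonneg h (h2.1 h)
    · have h' : ¬ 0 ≤ a j := fun hh => h (h2.2 hh)
      exact mul_nonneg_of_nonpos_of_nonpos (not_le.1 h).le (not_le.1 h').le
  · intro k κ
    by_cases hk : κ.1 k = true
    · left
      intro i hi
      have : g i = κ := hi
      rw [← this] at hk
      simpa [g, pattern, Matrix.mulVec, dotProduct] using hk
    · right
      intro i hi
      have : g i = κ := hi
      rw [← this] at hk
      simp [g, pattern, Matrix.mulVec, dotProduct] at hk
      exact hk.le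

lemma gset_joined {n d m : ℕ} 
    (X : Matrix (Fin n) (Fin d) ℝ) (y : Fin n → ℝ)
    (Q : Set (Finset (Fin d → ℝ) × ℝ)) (c : ℝ)
    (hm : 4 * Set.ncard (Set.range (pattern X)) ≤ m)
    (A B : Matrix (Fin d) (Fin m) ℝ × (Fin m → ℝ)) (hA : A ∈ gset X y Q c) (hB : B ∈ gset X y Q c) :
    JoinedIn (gset X y Q c) A B := by
  obtain ⟨A', hA', jA, SA, cA, sA⟩ := reduce X y Q c A hA
  obtain ⟨B', hB', jB, SB, cB, sB⟩ := reduce X y Q c B hB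
  exact (jA.trans (join_supp X y Q c A' hA' SA sA _ B' hB' SB sB (by omega) rfl)).trans jB.symm

lemma l2_le {M : Type*} [Fintype M] (v : M → ℝ) {c : ℝ} (hc : 0 ≤ c) :
    l2norm v ≤ c ↔ ∑ i, v i ^ 2 ≤ c ^ 2 := by
  unfold l2norm
  rw [Real.sqrt_le_left hc]

lemma frob_rep {d m : ℕ} {c : ℝ} (hc : 0 ≤ c) : ∃ Q : Set (Finset (Fin d → ℝ) × ℝ),
    ∀ W : Matrix (Fin d) (Fin m) ℝ, frobNorm W ≤ c ↔ gcons Q W := by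
  classical
  refine ⟨{(Finset.univ.image fun r : Fin d => (Pi.single r 1 : Fin d → ℝ), c ^ 2)}, fun W => ?_⟩
  unfold frobNorm gcons
  rw [Real.sqrt_le_left hc]
  simp only [Set.mem_singleton_iff, forall_eq]
  rw [Finset.sum_image]
  · simp [Pi.single_apply]
  · intro r _ r' _ h
    by_contra hne
    have := congrFun h r
    simp [Pi.single_apply, hne] at this

lemma op_rep {d m : ℕ} {c : ℝ} (hc : 0 ≤ c) : ∃ Q : Set (Finset (Fin d → ℝ) × ℝ),
    ∀ W : Matrix (Fin d) (Fin m) ℝ, opNorm W ≤ c ↔ gcons Q W := by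
  refine ⟨Set.range fun x : Fin d → ℝ => ({x}, c ^ 2 * ∑ r, x r ^ 2), fun W => ?_⟩
  unfold gcons
  simp only [Set.forall_mem_range, Finset.sum_singleton]
  have swap : ∀ (x : Fin d → ℝ) (v : Fin m → ℝ),
      ∑ r, x r * W.mulVec v r = ∑ i, (∑ r, x r * W r i) * v i := by
    intro x v
    simp only [Matrix.mulVec, dotProduct, Finset.mul_sum, Finset.sum_mul]
    rw [Finset.sum_comm]
    exact Finset.sum_congr rfl fun _ _ => Finset.sum_congr rfl fun _ _ => by ring
  have final : ∀ S T : ℝ, 0 ≤ S → 0 ≤ T → S ^ 2 ≤ T * S → S ≤ T := by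
    intro S T hS hT h
    rcases hS.eq_or_lt with h0 | h0
    · rw [← h0]; exact hT
    · exact le_of_mul_le_mul_right (by linarith [sq S]) h0
  constructor
  · intro h x
    have hbdd : BddAbove (Set.range fun v : {v : Fin m → ℝ // l2norm v ≤ 1} =>
        l2norm (W.mulVec v.1)) := by
      refine ⟨frobNorm W, ?_⟩
      rintro _ ⟨⟨v, hv⟩, rfl⟩
      rw [l2_le v zero_le_one, one_pow] at hv
      simp only [l2norm, frobNorm]
      apply Real.sqrt_le_sqrt
      refine Finset.sum_le_sum fun r _ => ?_
      have cs : (∑ i, W r i * v i) ^ 2 ≤ (∑ i, W r i ^ 2) * ∑ i, v i ^ 2 :=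
        Finset.sum_mul_sq_le_sq_mul_sq _ _ _
      have : 0 ≤ ∑ i, W r i ^ 2 := Finset.sum_nonneg fun _ _ => sq_nonneg _
      simp only [Matrix.mulVec, dotProduct]
      nlinarith
    have hv : ∀ v : Fin m → ℝ, ∑ r, W.mulVec v r ^ 2 ≤ c ^ 2 * ∑ i, v i ^ 2 := by
      intro v
      have hs : 0 ≤ ∑ i, v i ^ 2 := Finset.sum_nonneg fun _ _ => sq_nonneg _
      rcases hs.eq_or_lt with h0 | h0
      · have hv0 : v = 0 := by
          funext i
          have := (Finset.sum_eq_zero_iff_of_nonneg (fun j _ => sq_nonneg (v j))).1 h0.symm i (by simp)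
          simpa using this
        simp [hv0]
      · have hsq : 0 < √(∑ i, v i ^ 2) := Real.sqrt_pos.2 h0
        set z := √(∑ i, v i ^ 2) with hz
        have hz2 : z ^ 2 = ∑ i, v i ^ 2 := Real.sq_sqrt hs
        have hw : l2norm (z⁻¹ • v) ≤ 1 := by
          rw [l2_le _ zero_le_one]
          simp only [Pi.smul_apply, smul_eq_mul, mul_pow, ← Finset.mul_sum]
          rw [← hz2]
          apply le_of_eq
          field_simp
        have := (le_ciSup hbdd ⟨z⁻¹ • v, hw⟩).trans h
        rw [l2_le _ hc] at this
        simp only [Matrix.mulVec_smul, Pi.smul_apply, smul_eq_mul, mul_pow, ← Finset.mul_sum] at this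
        rw [inv_pow, inv_mul_le_iff₀ (by positivity), hz2] at this
        linarith
    set w : Fin m → ℝ := fun i => ∑ r, x r * W r i with hw
    have hx : 0 ≤ ∑ r, x r ^ 2 := Finset.sum_nonneg fun _ _ => sq_nonneg _
    have hS : 0 ≤ ∑ i, w i ^ 2 := Finset.sum_nonneg fun _ _ => sq_nonneg _
    refine final _ _ hS (by positivity) ?_
    have e : ∑ i, w i ^ 2 = ∑ r, x r * W.mulVec w r := by
      rw [swap]; exact Finset.sum_congr rfl fun i _ => sq _
    calc (∑ i, w i ^ 2) ^ 2 = (∑ r, x r * W.mulVec w r) ^ 2 := by rw [e]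
      _ ≤ (∑ r, x r ^ 2) * ∑ r, W.mulVec w r ^ 2 := Finset.sum_mul_sq_le_sq_mul_sq _ _ _
      _ ≤ (∑ r, x r ^ 2) * (c ^ 2 * ∑ i, w i ^ 2) := mul_le_mul_of_nonneg_left (hv w) hx
      _ = _ := by ring
  · intro h
    haveI : Nonempty {v : Fin m → ℝ // l2norm v ≤ 1} := ⟨⟨0, by simp [l2norm]⟩⟩
    refine ciSup_le ?_
    rintro ⟨v, hv⟩
    rw [l2_le v zero_le_one, one_pow] at hv
    rw [l2_le _ hc]
    simp only
    set z := W.mulVec v with hz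
    have hS : 0 ≤ ∑ r, z r ^ 2 := Finset.sum_nonneg fun _ _ => sq_nonneg _
    refine final _ _ hS (by positivity) ?_
    have e : ∑ r, z r ^ 2 = ∑ i, (∑ r, z r * W r i) * v i := by
      rw [← swap]; exact Finset.sum_congr rfl fun i _ => sq _
    have hn : 0 ≤ ∑ i, (∑ r, z r * W r i) ^ 2 := Finset.sum_nonneg fun _ _ => sq_nonneg _
    calc (∑ r, z r ^ 2) ^ 2 = (∑ i, (∑ r, z r * W r i) * v i) ^ 2 := by rw [e]
      _ ≤ (∑ i, (∑ r, z r * W r i) ^ 2) * ∑ i, v i ^ 2 := Finset.sum_mul_sq_le_sq_mul_sq _ _ _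
      _ ≤ ∑ i, (∑ r, z r * W r i) ^ 2 := mul_le_of_le_one_right hn hv
      _ ≤ _ := h z

/-- for `R ∈ {Frobenius, operator}` and width `m ≥ 4P`, the regularized
solution set `O_R(λ)` is path-connected. -/
theorem intra_connectivity_frob_op {n d m : ℕ}
    (X : Matrix (Fin n) (Fin d) ℝ) (y : Fin n → ℝ)
    (lam : ℝ) (hlam : 0 < lam)
    (R : Matrix (Fin d) (Fin m) ℝ → ℝ) (Rv : (Fin m → ℝ) → ℝ)
    (hR : (R = frobNorm ∧ Rv = l2norm) ∨ (R = opNorm ∧ Rv = l2norm))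
    (hm : 4 * Set.ncard (Set.range (pattern X)) ≤ m) :
    ∀ A ∈ solSet X y R Rv lam, ∀ B ∈ solSet X y R Rv lam,
      JoinedIn (solSet X y R Rv lam) A B := by
  have hc : 0 ≤ 1 / lam := by positivity
  obtain ⟨Q, hQ⟩ : ∃ Q : Set (Finset (Fin d → ℝ) × ℝ),
      ∀ W : Matrix (Fin d) (Fin m) ℝ, R W ≤ 1 / lam ↔ gcons Q W := by
    rcases hR with ⟨rfl, -⟩ | ⟨rfl, -⟩
    · exact frob_rep hc
    · exact op_rep hc
  have hRv : Rv = l2norm := by rcases hR with ⟨-, h⟩ | ⟨-, h⟩ <;> exact h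
  have hset : solSet X y R Rv lam = gset X y Q ((1 / lam) ^ 2) := by
    ext p
    simp only [solSet, gset, Set.mem_ofPred_eq, hQ, hRv, l2_le _ hc, funext_iff, nnOut,
      Matrix.mulVec, dotProduct, Matrix.map_apply, Matrix.mul_apply]
  rw [hset]
  exact fun A hA B hB => gset_joined X y Q _ hm A B hA hB
end

section
/- Let (t, s) ∈ ℤ_{≥0}^{2P} and suppose the width satisfies m ≥ Σ_{i=1}^P (t_i + s_i). If P_{(t,s)} ≠ ∅ and (t, s) ∈ Z_A (i.e., (t,s) is a minimal element of Z under the componentwise order), then the (t, s)-equalized solution set O^{eq}_{‖·‖_max,(t,s)}(λ) is nonempty. -/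
open scoped BigOperators

/-- A pair `(W, α)` has inactive neurons removed: `αᵢ • Wᵢ = 0` implies `Wᵢ = 0` and `αᵢ = 0`. -/
def removedInactive {D M : Type*} (p : Matrix D M ℝ × (M → ℝ)) : Prop :=
  ∀ i, p.2 i • mcol p.1 i = 0 → mcol p.1 i = 0 ∧ p.2 i = 0

/-- The equalized solution set `O^{eq}_{‖·‖_max}(λ)`. -/
def eqSet {n d m : ℕ} (X : Matrix (Fin n) (Fin d) ℝ) (y : Fin n → ℝ) (lam : ℝ) :
    Set (Matrix (Fin d) (Fin m) ℝ × (Fin m → ℝ)) :=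
  {p ∈ solSet X y maxNorm linfNorm lam | removedInactive p ∧
    (∀ i, p.2 i = 0 ∨ p.2 i = 1 / lam ∨ p.2 i = -(1 / lam)) ∧
    ∀ i j : Fin m, i ≠ j → pattern X (mcol p.1 i) = pattern X (mcol p.1 j) →
      p.2 i = p.2 j → mcol p.1 i = mcol p.1 j}

/-- The `(t, s)`-equalized solution set `O^{eq}_{‖·‖_max,(t,s)}(λ)`, relative to an
enumeration `D` of the hyperplane arrangement patterns. -/
def tsEqSet {n d m P : ℕ} (X : Matrix (Fin n) (Fin d) ℝ) (y : Fin n → ℝ) (lam : ℝ)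
    (D : Fin P → (Fin n → Bool)) (t s : Fin P → ℕ) :
    Set (Matrix (Fin d) (Fin m) ℝ × (Fin m → ℝ)) :=
  {p ∈ eqSet X y lam | ∀ pp : Fin P,
     Set.ncard {i : Fin m | pattern X (mcol p.1 i) = D pp ∧ 0 < p.2 i} = t pp ∧
     Set.ncard {i : Fin m | pattern X (mcol p.1 i) = D pp ∧ p.2 i < 0} = s pp}

/-- The convexified `(t, s)`-solution set `P_{(t,s)}`. -/
def convexSet {n d P : ℕ} (X : Matrix (Fin n) (Fin d) ℝ) (y : Fin n → ℝ) (lam : ℝ)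
    (D : Fin P → (Fin n → Bool)) (t s : Fin P → ℕ) :
    Set ((Fin P → (Fin d → ℝ)) × (Fin P → (Fin d → ℝ))) :=
  {uv | (fun r => ∑ i, if D i r then X.mulVec (uv.1 i - uv.2 i) r else 0) = y ∧
    ∀ i : Fin P,
      linfNorm (uv.1 i) ≤ (t i : ℝ) / lam ^ 2 ∧ linfNorm (uv.2 i) ≤ (s i : ℝ) / lam ^ 2 ∧
      (uv.1 i ≠ 0 → pattern X (uv.1 i) = D i) ∧ (uv.2 i ≠ 0 → pattern X (uv.2 i) = D i)}

/-- `Z = {(t, s) : P_{(t,s)} ≠ ∅}`. -/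
def Zset {n d P : ℕ} (X : Matrix (Fin n) (Fin d) ℝ) (y : Fin n → ℝ) (lam : ℝ)
    (D : Fin P → (Fin n → Bool)) : Set ((Fin P → ℕ) × (Fin P → ℕ)) :=
  {ts | (convexSet X y lam D ts.1 ts.2).Nonempty}

theorem exists_fibers {Q : Type*} [Fintype Q] [DecidableEq Q] (c : Q → ℕ) (m : ℕ)
    (hm : ∑ q, c q ≤ m) :
    ∃ f : Fin m → Option Q, ∀ q, (Finset.univ.filter (fun j => f j = some q)).card = c q := by
  have hcard : Fintype.card (Σ q, Fin (c q)) ≤ Fintype.card (Fin m) := by simpa using hm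
  obtain ⟨e⟩ := Function.Embedding.nonempty_of_card_le hcard
  refine ⟨Function.extend e (fun k => some k.1) (fun _ => none), fun q => ?_⟩
  have : (Finset.univ.filter (fun j => Function.extend e (fun k : Σ q, Fin (c q) => some k.1)
      (fun _ => none) j = some q)) =
      (Finset.univ : Finset (Fin (c q))).image (fun l => e ⟨q, l⟩) := by
    ext j
    simp only [Finset.mem_filter, Finset.mem_univ, true_and, Finset.mem_image]
    constructor
    · intro h
      by_cases hj : ∃ k, e k = j
      · obtain ⟨⟨q', l⟩, rfl⟩ := hj
        rw [e.injective.extend_apply] at h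
        simp only [Option.some.injEq] at h
        subst h
        exact ⟨l, rfl⟩
      · rw [Function.extend_apply' _ _ _ hj] at h
        cases h
    · rintro ⟨l, rfl⟩
      rw [e.injective.extend_apply]
  rw [this, Finset.card_image_of_injective]
  · simp
  · intro a b hab
    have := e.injective hab
    simpa using this

theorem sum_fibers {Q : Type*} [Fintype Q] [DecidableEq Q] {c : Q → ℕ} {m : ℕ}
    {f : Fin m → Option Q}
    (hf : ∀ q, (Finset.univ.filter (fun j => f j = some q)).card = c q)
    (g : Option Q → ℝ) (g0 : g none = 0) : ∑ j, g (f j) = ∑ q, (c q : ℝ) * g (some q) := by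
  have h := Finset.sum_fiberwise (Finset.univ : Finset (Fin m)) f (fun j => g (f j))
  rw [← h, Fintype.sum_option]
  have h1 : ∀ o : Option Q, ∑ j ∈ Finset.univ.filter (fun j => f j = o), g (f j) =
      ((Finset.univ.filter (fun j => f j = o)).card : ℝ) * g o := by
    intro o
    rw [Finset.sum_congr rfl (g := fun _ => g o)]
    · simp
    · intro j hj
      rw [(Finset.mem_filter.1 hj).2]
  simp only [h1, g0, hf, mul_zero, zero_add]

theorem linf_le {M : Type*} [Fintype M] {v : M → ℝ} {a : ℝ} (h : linfNorm v ≤ a) (i : M) :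
    |v i| ≤ a :=
  (le_ciSup (f := fun i => |v i|) (Set.finite_range _).bddAbove i).trans h

theorem pattern_smul {n d : ℕ} (X : Matrix (Fin n) (Fin d) ℝ) (v : Fin d → ℝ) (a : ℝ)
    (ha : 0 < a) : pattern X (a • v) = pattern X v := by
  funext i
  simp [pattern, Matrix.mulVec_smul, ha]

theorem relu_smul {n d : ℕ} (X : Matrix (Fin n) (Fin d) ℝ) (v : Fin d → ℝ) (a : ℝ)
    (ha : 0 < a) (r : Fin n) (p : Fin n → Bool) (hp : pattern X v = p) :
    relu (X.mulVec (a • v) r) = a * (if p r then X.mulVec v r else 0) := by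
  subst hp
  rw [Matrix.mulVec_smul]
  simp only [pattern, decide_eq_true_eq, relu, Pi.smul_apply, smul_eq_mul]
  split_ifs with h
  · exact max_eq_left (by positivity)
  · rw [mul_zero]
    exact max_eq_right (mul_nonpos_of_nonneg_of_nonpos ha.le (not_le.1 h).le)

theorem core {n d m P : ℕ}
    (X : Matrix (Fin n) (Fin d) ℝ) (y : Fin n → ℝ)
    (lam : ℝ) (hlam : 0 < lam)
    (D : Fin P → (Fin n → Bool)) (hDinj : Function.Injective D)
    (c : Fin P ⊕ Fin P → ℕ) (hm : ∑ q, c q ≤ m)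
    (z : Fin P ⊕ Fin P → Fin d → ℝ)
    (hz0 : ∀ q, z q = 0 → c q = 0)
    (hzb : ∀ q k, |z q k| ≤ (c q : ℝ) / lam ^ 2)
    (hzp : ∀ q, z q ≠ 0 → pattern X (z q) = D (Sum.elim id id q))
    (hy : ∀ r, ∑ i, (if D i r then X.mulVec (z (.inl i) - z (.inr i)) r else 0) = y r) :
    (tsEqSet (m := m) X y lam D (fun i => c (.inl i)) (fun i => c (.inr i))).Nonempty := by
  classical
  obtain ⟨f, hf⟩ := exists_fibers c m hm
  have hcz : ∀ q, c q = 0 → z q = 0 := by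
    intro q hq
    funext k
    have := hzb q k
    rw [hq] at this
    simpa using this
  have hpos : ∀ j q, f j = some q → 0 < c q := by
    intro j q h
    rw [← hf q]
    exact Finset.card_pos.2 ⟨j, by simp [h]⟩
  set w : Option (Fin P ⊕ Fin P) → Fin d → ℝ :=
    fun o => o.elim 0 (fun q => (lam / c q) • z q) with hw
  set al : Option (Fin P ⊕ Fin P) → ℝ :=
    fun o => o.elim 0 (Sum.elim (fun _ => 1 / lam) (fun _ => -(1 / lam))) with hal
  have hil : 0 < 1 / lam := by positivity
  have hsc : ∀ q, 0 < c q → 0 < lam / (c q : ℝ) := fun q h => by positivity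
  have hpat : ∀ q, 0 < c q → pattern X (w (some q)) = D (Sum.elim id id q) := by
    intro q hq
    have : z q ≠ 0 := fun h => hq.ne' (hz0 q h)
    simp only [hw, Option.elim_some]
    rw [pattern_smul _ _ _ (hsc q hq), hzp q this]
  have hwb : ∀ o k, |w o k| ≤ 1 / lam := by
    rintro (_ | q) k
    · simp [hw, hlam.le]
    · by_cases hq : c q = 0
      · simp [hw, hq, hlam.le]
      · have hq' : 0 < (c q : ℝ) := by exact_mod_cast Nat.pos_of_ne_zero hq
        have h := hzb q k
        simp only [hw, Option.elim_some, Pi.smul_apply, smul_eq_mul, abs_mul,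
          abs_of_pos (div_pos hlam hq')]
        calc lam / c q * |z q k| ≤ lam / c q * ((c q : ℝ) / lam ^ 2) := by gcongr
          _ = 1 / lam := by field_simp
  have halb : ∀ o, |al o| ≤ 1 / lam := by
    rintro (_ | q | q)
    · simp [hal, hlam.le]
    · simp [hal, abs_of_pos hlam]
    · simp [hal, abs_of_pos hlam]
  have hcol : ∀ j, mcol (Matrix.of fun k j => w (f j) k : Matrix (Fin d) (Fin m) ℝ) j = w (f j) :=
    fun j => rfl
  refine ⟨(Matrix.of fun k j => w (f j) k, fun j => al (f j)),
    ⟨⟨?_, ?_, ?_⟩, ?_, ?_, ?_⟩, ?_⟩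
  · funext r
    have : nnOut X (Matrix.of fun k j => w (f j) k) (fun j => al (f j)) r =
        ∑ j, (fun o => relu (X.mulVec (w o) r) * al o) (f j) := rfl
    simp only
    rw [this, sum_fibers hf (fun o => relu (X.mulVec (w o) r) * al o) (by simp [hal]), ← hy r, Fintype.sum_sum_type,
      ← Finset.sum_add_distrib]
    have key : ∀ q, (c q : ℝ) * relu (X.mulVec (w (some q)) r) =
        lam * (if D (Sum.elim id id q) r then X.mulVec (z q) r else 0) := by
      intro q
      by_cases hq : c q = 0
      · simp [hq, hcz q hq]
      · have hq' := Nat.pos_of_ne_zero hq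
        have hz : z q ≠ 0 := fun h => hq (hz0 q h)
        simp only [hw, Option.elim_some]
        rw [relu_smul X (z q) _ (hsc q hq') r _ (hzp q hz)]
        have : (c q : ℝ) ≠ 0 := by exact_mod_cast hq
        field_simp
    refine Finset.sum_congr rfl fun i _ => ?_
    have k1 := key (.inl i)
    have k2 := key (.inr i)
    change _ = lam * (if D i r then _ else _) at k1
    change _ = lam * (if D i r then _ else _) at k2
    rw [← mul_assoc, ← mul_assoc, Matrix.mulVec_sub]
    simp only [hal, Option.elim_some, Sum.elim_inl, Sum.elim_inr, Pi.sub_apply]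
    by_cases hD : D i r = true
    · rw [if_pos hD] at k1 k2 ⊢
      rw [k1, k2]
      field_simp
      ring
    · rw [if_neg hD] at k1 k2 ⊢
      rw [k1, k2]
      simp
  · exact Real.iSup_le (fun k => Real.iSup_le (fun j => hwb _ _) hil.le) hil.le
  · exact Real.iSup_le (fun j => halb _) hil.le
  · intro j h
    simp only [hcol] at h ⊢
    rcases hfj : f j with _ | q
    · simp [hw, hal]
    · exfalso
      rw [hfj] at h
      have hq := hpos j q hfj
      have hz : z q ≠ 0 := fun h => hq.ne' (hz0 q h)
      rcases smul_eq_zero.1 h with h | h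
      · rcases q with q | q <;> simp [hal, hlam.ne'] at h
      · simp only [hw, Option.elim_some] at h
        rcases smul_eq_zero.1 h with h | h
        · exact (hsc q hq).ne' h
        · exact hz h
  · intro j
    simp only
    rcases f j with _ | q | q <;> simp [hal]
  · intro i j _ hp ha
    simp only [hcol] at hp ha ⊢
    have : f i = f j := by
      rcases hi : f i with _ | q <;> rcases hj : f j with _ | q'
      · rfl
      · rw [hi, hj] at ha
        rcases q' with q' | q' <;> simp [hal, hlam.ne', hlam.ne] at ha
      · rw [hi, hj] at ha
        rcases q with q | q <;> simp [hal, hlam.ne', hlam.ne] at ha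
      · rw [hi, hj] at ha hp
        rw [hpat q (hpos _ _ hi), hpat q' (hpos _ _ hj)] at hp
        have hp := hDinj hp
        rcases q with q | q <;> rcases q' with q' | q' <;>
          simp only [Sum.elim_inl, Sum.elim_inr, id] at hp <;>
          simp only [hal, Option.elim_some, Sum.elim_inl, Sum.elim_inr] at ha <;>
          first
          | (exfalso; linarith)
          | rw [hp]
    rw [this]
  · intro pp
    simp only [hcol]
    constructor
    · rw [← hf (.inl pp), ← Set.ncard_coe_finset]
      congr 1
      ext j
      simp only [Set.mem_setOf_eq, Finset.coe_filter, Finset.mem_univ, true_and]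
      constructor
      · rintro ⟨h1, h2⟩
        rcases hj : f j with _ | q | q
        · rw [hj] at h2; simp [hal] at h2
        · rw [hj, hpat _ (hpos _ _ hj)] at h1
          have := hDinj h1
          simp only [Sum.elim_inl, id] at this
          rw [this]
        · rw [hj] at h2
          simp only [hal, Option.elim_some, Sum.elim_inr] at h2
          linarith
      · intro hj
        rw [hj, hpat _ (hpos _ _ hj)]
        exact ⟨rfl, hil⟩
    · rw [← hf (.inr pp), ← Set.ncard_coe_finset]
      congr 1
      ext j
      simp only [Set.mem_setOf_eq, Finset.coe_filter, Finset.mem_univ, true_and]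
      constructor
      · rintro ⟨h1, h2⟩
        rcases hj : f j with _ | q | q
        · rw [hj] at h2; simp [hal] at h2
        · rw [hj] at h2
          simp only [hal, Option.elim_some, Sum.elim_inl] at h2
          linarith
        · rw [hj, hpat _ (hpos _ _ hj)] at h1
          have := hDinj h1
          simp only [Sum.elim_inr, id] at this
          rw [this]
      · intro hj
        rw [hj, hpat _ (hpos _ _ hj)]
        exact ⟨rfl, neg_lt_zero.2 hil⟩

theorem linf_zero {M : Type*} [Fintype M] : linfNorm (0 : M → ℝ) = 0 := by
  simp [linfNorm]

/-- if `m ≥ Σᵢ (tᵢ + sᵢ)`, `P_{(t,s)} ≠ ∅` and `(t, s)` is a minimal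
element of `Z`, then the `(t, s)`-equalized solution set is nonempty. -/
theorem tsEqSet_nonempty {n d m P : ℕ}
    (X : Matrix (Fin n) (Fin d) ℝ) (y : Fin n → ℝ)
    (lam : ℝ) (hlam : 0 < lam)
    (D : Fin P → (Fin n → Bool)) (hDinj : Function.Injective D)
    (hDrange : Set.range D = Set.range (pattern X))
    (t s : Fin P → ℕ) (hm : ∑ i, (t i + s i) ≤ m)
    (hne : (convexSet X y lam D t s).Nonempty)
    (hmin : Minimal (· ∈ Zset X y lam D) (t, s)) :
    (tsEqSet (m := m) X y lam D t s).Nonempty := by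
  obtain ⟨⟨u, v⟩, hy, huv⟩ := hne
  simp only at hy huv
  have ht0 : ∀ i, u i = 0 → t i = 0 := by
    intro i hi
    have hle : (Function.update t i 0, s) ≤ (t, s) :=
      ⟨update_le_iff.2 ⟨Nat.zero_le _, fun _ _ => le_rfl⟩, le_rfl⟩
    have hmem : (Function.update t i 0, s) ∈ Zset X y lam D := by
      refine ⟨(u, v), hy, fun j => ⟨?_, (huv j).2⟩⟩
      by_cases hj : j = i
      · subst hj
        simp [hi, linf_zero]
      · simpa [Function.update_of_ne hj] using (huv j).1
    have := (hmin.2 hmem hle).1 i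
    simpa using this
  have hs0 : ∀ i, v i = 0 → s i = 0 := by
    intro i hi
    have hle : (t, Function.update s i 0) ≤ (t, s) :=
      ⟨le_rfl, update_le_iff.2 ⟨Nat.zero_le _, fun _ _ => le_rfl⟩⟩
    have hmem : (t, Function.update s i 0) ∈ Zset X y lam D := by
      refine ⟨(u, v), hy, fun j => ⟨(huv j).1, ?_, (huv j).2.2⟩⟩
      by_cases hj : j = i
      · subst hj
        simp [hi, linf_zero]
      · simpa [Function.update_of_ne hj] using (huv j).2.1
    have := (hmin.2 hmem hle).2 i
    simpa using this
  refine core X y lam hlam D hDinj (Sum.elim t s) ?_ (Sum.elim u v) ?_ ?_ ?_ ?_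
  · simpa [Fintype.sum_sum_type, ← Finset.sum_add_distrib] using hm
  · rintro (i | i)
    · exact ht0 i
    · exact hs0 i
  · rintro (i | i) k
    · exact linf_le (huv i).1 k
    · exact linf_le (huv i).2.1 k
  · rintro (i | i)
    · exact (huv i).2.2.1
    · exact (huv i).2.2.2
  · intro r
    exact congrFun hy r
end
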